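/- Let w : S₄ → ℝ satisfy: for every σ ∈ S₄, Σ_{τ ∈ S₄} 4^{c(τ)} · w(τ⁻¹σ) equals 1 if σ is the identity and 0 otherwise. Then for all 4×4 complex matrices A₁, A₂, A₃, A₄, B₁, B₂, B₃, B₄: ∫ Tr( V^{⊗4} (A₁⊗A₂⊗A₃⊗A₄) (V^{⊗4})† (B₁⊗B₂⊗B₃⊗B₄) ) dμ(V) = Σ_{τ,π ∈ S₄} w(τ∘π) · Tr( W_τ (A₁⊗A₂⊗A₃⊗A₄) ) · Tr( W_π (B₁⊗B₂⊗B₃⊗B₄) ). -/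

import Mathlib

open Matrix MeasureTheory
open scoped Kronecker

noncomputable instance : MeasurableSpace (Matrix.unitaryGroup (Fin 4) ℂ) := borel _
instance : BorelSpace (Matrix.unitaryGroup (Fin 4) ℂ) := ⟨rfl⟩

/-- The number of cycles of a permutation of `{1,2,3,4}`, counting fixed points as cycles
of length 1. -/
def cycleCount (π : Equiv.Perm (Fin 4)) : ℕ :=
  π.cycleType.card + (Finset.univ.filter fun a => π a = a).card

/-- The permutation operator `W_π` on `(ℂ⁴)^{⊗4}`: the `256×256` matrix, with rows and
columns indexed by tuples `i ∈ {1,2,3,4}⁴`, whose `(i,j)` entry is `1` if `i_a = j_{π(a)}`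
for every `a` and `0` otherwise. -/
def permOp (π : Equiv.Perm (Fin 4)) :
    Matrix (Fin 4 → Fin 4) (Fin 4 → Fin 4) ℂ :=
  fun i j => if ∀ a, i a = j (π a) then 1 else 0

/-- The Kronecker product `A₁ ⊗ A₂ ⊗ A₃ ⊗ A₄` of `4×4` matrices, with rows and columns
indexed by tuples in `{1,2,3,4}⁴`: its `(i,j)` entry is `∏ a, (A_a)_{i_a, j_a}`. -/
def kronPow (A : Fin 4 → Matrix (Fin 4) (Fin 4) ℂ) :
    Matrix (Fin 4 → Fin 4) (Fin 4 → Fin 4) ℂ :=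
  fun i j => ∏ a, A a (i a) (j a)

open scoped Matrix.Norms.Elementwise

lemma kronPow_mul_kronPow (A B : Fin 4 → Matrix (Fin 4) (Fin 4) ℂ) :
    kronPow A * kronPow B = kronPow fun a => A a * B a := by
  ext i j
  simp only [kronPow, Matrix.mul_apply, Finset.prod_univ_sum, Fintype.piFinset_univ,
    Finset.prod_mul_distrib]

lemma kronPow_one : kronPow (fun _ => 1) = 1 := by
  ext i j
  simp only [kronPow, Matrix.one_apply, Finset.prod_ite_zero, Finset.prod_const_one,
    Finset.mem_univ, true_imp_iff, funext_iff]

lemma conjTranspose_kronPow (A : Fin 4 → Matrix (Fin 4) (Fin 4) ℂ) :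
    (kronPow A)ᴴ = kronPow fun a => (A a)ᴴ := by
  ext i j
  simp [kronPow, Matrix.conjTranspose_apply]

lemma permOp_mul_apply (π : Equiv.Perm (Fin 4)) (X : Matrix (Fin 4 → Fin 4) (Fin 4 → Fin 4) ℂ)
    (i j : Fin 4 → Fin 4) : (permOp π * X) i j = X (i ∘ π.symm) j := by
  rw [Matrix.mul_apply, Finset.sum_eq_single (i ∘ π.symm)]
  · simp [permOp]
  · intro k _ hk
    have : ¬ ∀ a, i a = k (π a) := fun h => hk (funext fun a => by simp [h])
    simp [permOp, this]
  · simp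

lemma permOp_mul_permOp (σ π : Equiv.Perm (Fin 4)) :
    permOp σ * permOp π = permOp (π * σ) := by
  ext i j
  rw [permOp_mul_apply]
  simp only [permOp]
  refine if_congr ⟨fun h a => ?_, fun h a => ?_⟩ rfl rfl
  · simpa using h (σ a)
  · simpa using h (σ.symm a)

lemma trace_permOp (π : Equiv.Perm (Fin 4)) : (permOp π).trace = 4 ^ cycleCount π := by
  have key : ∀ π : Equiv.Perm (Fin 4),
      (Finset.univ.filter fun i : Fin 4 → Fin 4 => ∀ a, i a = i (π a)).card =
        4 ^ cycleCount π := by decide +kernel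
  simp only [Matrix.trace, Matrix.diag_apply, permOp, Finset.sum_boole]
  rw [key π, Nat.cast_pow, Nat.cast_ofNat]

lemma cycleCount_inv (π : Equiv.Perm (Fin 4)) : cycleCount π⁻¹ = cycleCount π := by
  simp only [cycleCount, Equiv.Perm.cycleType_inv, Equiv.Perm.inv_eq_iff_eq,
    eq_comm (b := π _)]

lemma trace_permOp_mul_permOp (σ π : Equiv.Perm (Fin 4)) :
    (permOp σ * permOp π).trace = 4 ^ cycleCount (π⁻¹ * σ⁻¹) := by
  rw [Matrix.trace_mul_comm, permOp_mul_permOp, trace_permOp, ← _root_.mul_inv_rev, cycleCount_inv]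

lemma permOp_mul_kronPow_const (π : Equiv.Perm (Fin 4)) (V : Matrix (Fin 4) (Fin 4) ℂ) :
    permOp π * kronPow (fun _ => V) = kronPow (fun _ => V) * permOp π := by
  ext i j
  rw [permOp_mul_apply, Matrix.mul_apply, Finset.sum_eq_single (j ∘ π)]
  · simp only [permOp, kronPow, Function.comp_apply, implies_true, if_true, mul_one]
    rw [← Equiv.prod_comp π]
    simp
  · intro k _ hk
    have : ¬ ∀ a, k a = j (π a) := fun h => hk (funext h)
    simp [permOp, this]
  · simp

/-- A square matrix with pairwise orthogonal rows is a unitary matrix with rescaled rows. -/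
lemma exists_eq_diagonal_mul_unitary {n : Type*} [Fintype n] [DecidableEq n] [LinearOrder n]
    [LocallyFiniteOrderBot n] [WellFoundedLT n] (M : Matrix n n ℂ)
    (hM : ∀ k l, k ≠ l → ∑ a, M k a * star (M l a) = 0) :
    ∃ (d : n → ℂ) (U : Matrix n n ℂ), U ∈ Matrix.unitaryGroup n ℂ ∧ M = diagonal d * U := by
  let f : n → EuclideanSpace ℂ n := fun k => WithLp.toLp 2 (M k)
  have hf : Pairwise fun k l => inner ℂ (f k) (f l) = 0 := fun k l hkl => by
    simpa [f, PiLp.inner_apply] using hM l k hkl.symm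
  let b := InnerProductSpace.gramSchmidtOrthonormalBasis (𝕜 := ℂ) (by simp) f
  refine ⟨fun k => ‖f k‖, of fun k a => b k a, ?_, ?_⟩
  · rw [Matrix.mem_unitaryGroup_iff]
    ext k l
    have h := orthonormal_iff_ite.mp b.orthonormal l k
    rw [PiLp.inner_apply] at h
    simpa [Matrix.mul_apply, Matrix.star_apply, Matrix.one_apply, eq_comm] using h
  · ext k a
    rw [Matrix.diagonal_mul, Matrix.of_apply]
    by_cases h : f k = 0
    · have : M k a = 0 := congrArg (fun v : EuclideanSpace ℂ n => v a) h
      simp [h, this]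
    · have hb : b k = _ :=
        InnerProductSpace.gramSchmidtOrthonormalBasis_apply_of_orthogonal (by simp) hf h
      have h' : (‖f k‖ : ℂ) ≠ 0 := by simpa using h
      rw [hb, PiLp.smul_apply, smul_eq_mul]
      exact (mul_inv_cancel_left₀ h' _).symm

lemma kronPow_diagonal (d : Fin 4 → ℂ) :
    kronPow (fun _ => diagonal d) = diagonal fun i => ∏ a, d (i a) := by
  ext i j
  simp only [kronPow, Matrix.diagonal_apply, Finset.prod_ite_zero, Finset.mem_univ,
    true_imp_iff, funext_iff]

/-- Commuting with the fourth tensor powers of the diagonal unitaries forces an operator to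
preserve weights. -/
lemma card_fiber_eq_of_commute {X : Matrix (Fin 4 → Fin 4) (Fin 4 → Fin 4) ℂ}
    (hX : ∀ V ∈ Matrix.unitaryGroup (Fin 4) ℂ,
      X * kronPow (fun _ => V) = kronPow (fun _ => V) * X)
    {i j : Fin 4 → Fin 4} (hij : X i j ≠ 0) (k : Fin 4) :
    (Finset.univ.filter fun a => i a = k).card = (Finset.univ.filter fun a => j a = k).card := by
  obtain ⟨ζ, hζ⟩ : ∃ ζ : ℂ, IsPrimitiveRoot ζ 5 :=
    ⟨_, Complex.isPrimitiveRoot_exp 5 (by norm_num)⟩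
  have hnorm : ζ * star ζ = 1 := by
    rw [Complex.star_def, Complex.mul_conj', hζ.norm'_eq_one (by norm_num)]
    norm_num
  let d : Fin 4 → ℂ := fun l => if l = k then ζ else 1
  have hd : diagonal d ∈ Matrix.unitaryGroup (Fin 4) ℂ := by
    rw [Matrix.mem_unitaryGroup_iff, Matrix.star_eq_conjTranspose,
      Matrix.diagonal_conjTranspose, Matrix.diagonal_mul_diagonal, ← Matrix.diagonal_one]
    congr 1
    ext l
    by_cases hl : l = k
    · simpa [d, hl] using hnorm
    · simp [d, hl]
  have h := congrFun (congrFun (hX _ hd) i) j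
  rw [kronPow_diagonal, Matrix.mul_diagonal, Matrix.diagonal_mul, mul_comm] at h
  have h := mul_right_cancel₀ hij h
  simp only [d, Finset.prod_ite, Finset.prod_const, one_pow, mul_one] at h
  have hlt : ∀ g : Fin 4 → Fin 4, (Finset.univ.filter fun a => g a = k).card < 5 := fun g =>
    Nat.lt_succ_of_le (Finset.card_le_univ _)
  exact hζ.pow_inj (hlt i) (hlt j) h.symm

lemma commute_kronPow_diagonal {X : Matrix (Fin 4 → Fin 4) (Fin 4 → Fin 4) ℂ}
    (hX : ∀ V ∈ Matrix.unitaryGroup (Fin 4) ℂ,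
      X * kronPow (fun _ => V) = kronPow (fun _ => V) * X) (d : Fin 4 → ℂ) :
    X * kronPow (fun _ => diagonal d) = kronPow (fun _ => diagonal d) * X := by
  ext i j
  rw [kronPow_diagonal, Matrix.mul_diagonal, Matrix.diagonal_mul, mul_comm]
  by_cases hij : X i j = 0
  · simp [hij]
  · rw [← Finset.prod_fiberwise' Finset.univ i, ← Finset.prod_fiberwise' Finset.univ j]
    simp only [Finset.prod_const, card_fiber_eq_of_commute hX hij]

/-- The commutant of the fourth tensor powers of unitary `4 × 4` matrices is spanned by the
permutation operators. -/
lemma eq_sum_permOp_of_commute {X : Matrix (Fin 4 → Fin 4) (Fin 4 → Fin 4) ℂ}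
    (hX : ∀ V ∈ Matrix.unitaryGroup (Fin 4) ℂ,
      X * kronPow (fun _ => V) = kronPow (fun _ => V) * X) :
    X = ∑ ρ : Equiv.Perm (Fin 4), X ρ id • permOp ρ := by
  ext i j
  let M : Matrix (Fin 4) (Fin 4) ℂ := of fun k a => if k = j a then 1 else 0
  have hM : X * kronPow (fun _ => M) = kronPow (fun _ => M) * X := by
    obtain ⟨d, U, hU, hdU⟩ := exists_eq_diagonal_mul_unitary M fun k l hkl =>
      Finset.sum_eq_zero fun a _ => by
        by_cases h : k = j a
        · have : l ≠ j a := fun h' => hkl (h.trans h'.symm)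
          simp [M, this]
        · simp [M, h]
    rw [hdU, ← kronPow_mul_kronPow, ← Matrix.mul_assoc, commute_kronPow_diagonal hX,
      Matrix.mul_assoc, hX U hU, Matrix.mul_assoc]
  have hij := congrFun (congrFun hM i) id
  have hj : ∀ k : Fin 4 → Fin 4, (∀ a, k a = j a) ↔ k = j := fun k => funext_iff.symm
  simp only [Matrix.mul_apply, kronPow, M, Matrix.of_apply, Finset.prod_ite_zero,
    Finset.prod_const_one, Finset.mem_univ, true_imp_iff, id_eq, hj, mul_ite, mul_one,
    mul_zero, ite_mul, one_mul, zero_mul, Finset.sum_ite_eq', if_true] at hij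
  rw [hij, Matrix.sum_apply]
  symm
  refine Fintype.sum_of_injective (fun ρ : Equiv.Perm (Fin 4) => (ρ : Fin 4 → Fin 4))
    DFunLike.coe_injective _ _ (fun k hk => ?_) fun ρ => ?_
  · by_contra hne
    have hXk : X k id ≠ 0 := fun h => hne (by simp [h])
    refine hk ⟨Equiv.ofBijective k (Finite.surjective_iff_bijective.mp fun l => ?_), rfl⟩
    have hpos : 0 < (Finset.univ.filter fun a => k a = l).card := by
      rw [card_fiber_eq_of_commute hX hXk l]
      exact Finset.card_pos.mpr ⟨l, by simp⟩
    obtain ⟨a, ha⟩ := Finset.card_pos.mp hpos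
    exact ⟨a, (Finset.mem_filter.mp ha).2⟩
  · simp [permOp]

/-- The average of `V^{⊗4} M (V^{⊗4})†` with respect to `μ`. -/
noncomputable def twirl (μ : Measure (Matrix.unitaryGroup (Fin 4) ℂ))
    (M : Matrix (Fin 4 → Fin 4) (Fin 4 → Fin 4) ℂ) :
    Matrix (Fin 4 → Fin 4) (Fin 4 → Fin 4) ℂ :=
  ∫ V : Matrix.unitaryGroup (Fin 4) ℂ, kronPow (fun _ => (V : Matrix (Fin 4) (Fin 4) ℂ)) * M *
    (kronPow (fun _ => (V : Matrix (Fin 4) (Fin 4) ℂ)))ᴴ ∂μ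

lemma continuous_kronPow_const :
    Continuous fun V : Matrix.unitaryGroup (Fin 4) ℂ =>
      kronPow (fun _ => (V : Matrix (Fin 4) (Fin 4) ℂ)) := by
  refine continuous_matrix fun i j => ?_
  simp only [kronPow]
  exact continuous_finsetProd _ fun a _ =>
    (continuous_apply_apply (i a) (j a)).comp continuous_subtype_val

instance : CompactSpace (Matrix.unitaryGroup (Fin 4) ℂ) := by
  suffices h : IsCompact {U : Matrix (Fin 4) (Fin 4) ℂ | U ∈ Matrix.unitaryGroup (Fin 4) ℂ} from
    isCompact_iff_compactSpace.mp h
  have hclosed : IsClosed {U : Matrix (Fin 4) (Fin 4) ℂ | U ∈ Matrix.unitaryGroup (Fin 4) ℂ} :=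
    isClosed_unitary
  refine Metric.isCompact_of_isClosed_isBounded hclosed ?_
  refine (Metric.isBounded_closedBall (x := (0 : Matrix (Fin 4) (Fin 4) ℂ)) (r := 1)).subset ?_
  intro U hU
  simpa using entrywise_sup_norm_bound_of_unitary hU

lemma linearMap_twirl {E : Type*} [NormedAddCommGroup E] [NormedSpace ℂ E] [CompleteSpace E]
    (μ : Measure (Matrix.unitaryGroup (Fin 4) ℂ)) [IsFiniteMeasure μ]
    (L : Matrix (Fin 4 → Fin 4) (Fin 4 → Fin 4) ℂ →ₗ[ℂ] E)
    (M : Matrix (Fin 4 → Fin 4) (Fin 4 → Fin 4) ℂ) :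
    L (twirl μ M) = ∫ V : Matrix.unitaryGroup (Fin 4) ℂ,
      L (kronPow (fun _ => (V : Matrix (Fin 4) (Fin 4) ℂ)) * M *
        (kronPow (fun _ => (V : Matrix (Fin 4) (Fin 4) ℂ)))ᴴ) ∂μ := by
  refine ((LinearMap.toContinuousLinearMap L).integral_comp_comm ?_).symm
  have h := continuous_kronPow_const
  rw [← integrableOn_univ]
  exact ((h.matrix_mul continuous_const).matrix_mul
    h.matrix_conjTranspose).continuousOn.integrableOn_compact isCompact_univ

lemma twirl_mul_kronPow (μ : Measure (Matrix.unitaryGroup (Fin 4) ℂ)) [IsFiniteMeasure μ]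
    [μ.IsMulLeftInvariant] (M : Matrix (Fin 4 → Fin 4) (Fin 4 → Fin 4) ℂ)
    {U : Matrix (Fin 4) (Fin 4) ℂ} (hU : U ∈ Matrix.unitaryGroup (Fin 4) ℂ) :
    twirl μ M * kronPow (fun _ => U) = kronPow (fun _ => U) * twirl μ M := by
  have hinv : kronPow (fun _ => U) * twirl μ M * kronPow (fun _ => Uᴴ) = twirl μ M := by
    have h := linearMap_twirl μ
      (LinearMap.mulLeftRight ℂ (kronPow (fun _ => U), kronPow (fun _ => Uᴴ))) M
    rw [LinearMap.mulLeftRight_apply] at h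
    rw [h, twirl]
    conv_rhs => rw [← integral_mul_left_eq_self _ (⟨U, hU⟩ : Matrix.unitaryGroup (Fin 4) ℂ)]
    congr 1
    ext1 V
    simp only [LinearMap.mulLeftRight_apply, conjTranspose_kronPow, Submonoid.coe_mul,
      Matrix.conjTranspose_mul, ← kronPow_mul_kronPow, Matrix.mul_assoc]
  have hUU : Uᴴ * U = 1 := Matrix.mem_unitaryGroup_iff'.mp hU
  nth_rw 1 [← hinv]
  rw [Matrix.mul_assoc, kronPow_mul_kronPow, hUU, kronPow_one, Matrix.mul_one]

lemma trace_permOp_mul_twirl (μ : Measure (Matrix.unitaryGroup (Fin 4) ℂ))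
    [IsProbabilityMeasure μ] (σ : Equiv.Perm (Fin 4))
    (M : Matrix (Fin 4 → Fin 4) (Fin 4 → Fin 4) ℂ) :
    (permOp σ * twirl μ M).trace = (permOp σ * M).trace := by
  have h := linearMap_twirl μ
    (Matrix.traceLinearMap _ ℂ ℂ ∘ₗ LinearMap.mulLeft ℂ (permOp σ)) M
  simp only [LinearMap.comp_apply, LinearMap.mulLeft_apply, Matrix.traceLinearMap_apply] at h
  rw [h]
  have hconst : ∀ V : Matrix.unitaryGroup (Fin 4) ℂ,
      (permOp σ * (kronPow (fun _ => (V : Matrix (Fin 4) (Fin 4) ℂ)) * M *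
        (kronPow (fun _ => (V : Matrix (Fin 4) (Fin 4) ℂ)))ᴴ)).trace =
      (permOp σ * M).trace := fun V => by
    have hV : (V : Matrix (Fin 4) (Fin 4) ℂ)ᴴ * (V : Matrix (Fin 4) (Fin 4) ℂ) = 1 :=
      Matrix.mem_unitaryGroup_iff'.mp V.2
    rw [← Matrix.mul_assoc, Matrix.trace_mul_comm, ← Matrix.mul_assoc (permOp σ),
      permOp_mul_kronPow_const, conjTranspose_kronPow, Matrix.mul_assoc, ← Matrix.mul_assoc,
      kronPow_mul_kronPow, hV, kronPow_one, Matrix.one_mul]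
  simp [hconst]

/-- Weingarten formula for the fourth moment: if `w : S₄ → ℝ` satisfies
`∑_{τ ∈ S₄} 4^{c(τ)} w(τ⁻¹σ) = [σ = id]` for every `σ`, then for all `4×4` complex matrices
`A₁,…,A₄, B₁,…,B₄`, with `μ` the Haar probability measure on `U(4)`:
`∫ Tr(V^{⊗4} (A₁⊗A₂⊗A₃⊗A₄) (V^{⊗4})† (B₁⊗B₂⊗B₃⊗B₄)) dμ(V)
  = ∑_{τ,π ∈ S₄} w(τ∘π) Tr(W_τ (A₁⊗A₂⊗A₃⊗A₄)) Tr(W_π (B₁⊗B₂⊗B₃⊗B₄))`. -/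
theorem weingarten_fourth_moment (w : Equiv.Perm (Fin 4) → ℝ)
    (hw : ∀ σ : Equiv.Perm (Fin 4),
      (∑ τ : Equiv.Perm (Fin 4), (4 : ℝ) ^ cycleCount τ * w (τ⁻¹ * σ)) =
        if σ = 1 then 1 else 0)
    (μ : Measure (Matrix.unitaryGroup (Fin 4) ℂ))
    [μ.IsHaarMeasure] [IsProbabilityMeasure μ]
    (A B : Fin 4 → Matrix (Fin 4) (Fin 4) ℂ) :
    (∫ V : Matrix.unitaryGroup (Fin 4) ℂ,
        (kronPow (fun _ => (V : Matrix (Fin 4) (Fin 4) ℂ)) * kronPow A *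
          (kronPow (fun _ => (V : Matrix (Fin 4) (Fin 4) ℂ)))ᴴ * kronPow B).trace ∂μ) =
      ∑ τ : Equiv.Perm (Fin 4), ∑ π : Equiv.Perm (Fin 4),
        (w (τ * π) : ℂ) * (permOp τ * kronPow A).trace * (permOp π * kronPow B).trace := by
  set E := twirl μ (kronPow A) with hE
  have hsum : E = ∑ ρ : Equiv.Perm (Fin 4), E ρ id • permOp ρ :=
    eq_sum_permOp_of_commute fun U hU => twirl_mul_kronPow μ _ hU
  have htrace : ∀ τ : Equiv.Perm (Fin 4), (permOp τ * kronPow A).trace =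
      ∑ ρ : Equiv.Perm (Fin 4), E ρ id * 4 ^ cycleCount (ρ⁻¹ * τ⁻¹) := fun τ => by
    rw [← trace_permOp_mul_twirl μ, ← hE, hsum]
    nth_rw 1 [hsum]
    simp only [Matrix.mul_sum, Matrix.mul_smul, Matrix.trace_sum, Matrix.trace_smul,
      trace_permOp_mul_permOp, smul_eq_mul]
  have hcoeff : ∀ ρ π : Equiv.Perm (Fin 4),
      ∑ τ : Equiv.Perm (Fin 4), (w (τ * π) : ℂ) * 4 ^ cycleCount (ρ⁻¹ * τ⁻¹) =
        if ρ = π then 1 else 0 := fun ρ π => by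
    have h := congrArg (Complex.ofReal) (hw (ρ⁻¹ * π))
    rw [← Equiv.sum_comp ((Equiv.inv _).trans (Equiv.mulLeft ρ⁻¹))] at h
    simpa [mul_assoc, mul_comm, inv_mul_eq_one, apply_ite Complex.ofReal] using h
  have hint := linearMap_twirl μ
    (Matrix.traceLinearMap _ ℂ ℂ ∘ₗ LinearMap.mulRight ℂ (kronPow B)) (kronPow A)
  simp only [LinearMap.comp_apply, LinearMap.mulRight_apply, Matrix.traceLinearMap_apply] at hint
  rw [← hint, ← hE, hsum, Finset.sum_comm]
  simp only [Matrix.sum_mul, Matrix.smul_mul, Matrix.trace_sum, Matrix.trace_smul, smul_eq_mul]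
  refine Finset.sum_congr rfl fun π _ => ?_
  rw [← Finset.sum_mul]
  congr 1
  simp only [htrace, Finset.mul_sum]
  rw [Finset.sum_comm]
  simp only [mul_left_comm _ (E _ _), ← Finset.mul_sum, hcoeff]
  simp
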